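/- For the binary-sequence example the two outer measures differ: let Ω = {0,1}^ℕ, for n ∈ ℕ let P_n be the probability measure assigning mass 1/2 to the all-zeros sequence 0^∞ and mass 1/2 to the sequence e_n that has a single one at position n+1 (after n zeros) and zeros elsewhere, let 𝒫 = {P_n : n ∈ ℕ}, and let A = {0^∞} be the singleton of the all-zeros sequence. Then sup_{n} P_n(A) = 1/2, μ*(A) = 1, and μ*(Ω \ A) = 1/2. -/

import Mathlib

open MeasureTheory Filter ENNReal

/-- A stopping time with values in `ℕ∞ = ℕ ∪ {∞}` with respect to a filtration `F`:
`{ω | τ ω ≤ t}` is `F t`-measurable for every `t ∈ ℕ`. -/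
def IsStopTime {Ω : Type*} {m : MeasurableSpace Ω} (F : Filtration ℕ m) (τ : Ω → ℕ∞) : Prop :=
  ∀ t : ℕ, MeasurableSet[F t] {ω | τ ω ≤ (t : ℕ∞)}

/-- The inverse-capital outer measure associated with a family `Ps` of measures:
`μ*(A) = inf { sup_{P ∈ Ps} P(τ < ∞) : τ a stopping time with A ⊆ {τ < ∞} }`. -/
noncomputable def invCap {Ω : Type*} {m : MeasurableSpace Ω} (F : Filtration ℕ m)
    (Ps : Set (Measure Ω)) (A : Set Ω) : ℝ≥0∞ :=
  ⨅ (τ : Ω → ℕ∞) (_ : IsStopTime F τ ∧ A ⊆ {ω | τ ω ≠ ⊤}),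
    ⨆ P ∈ Ps, P {ω | τ ω ≠ ⊤}


/-- The all-zeros binary sequence. -/
def zeroSeq : ℕ → Bool := fun _ => false

/-- The binary sequence with a single one after `n` zeros (at position `n+1`, i.e. index `n`)
and zeros elsewhere. -/
def oneAt (n : ℕ) : ℕ → Bool := fun i => decide (i = n)

/-- The measure assigning mass `1/2` to the all-zeros sequence and mass `1/2` to the sequence
with a single one after `n` zeros. -/
noncomputable def binMeasure (n : ℕ) : Measure (ℕ → Bool) :=
  (1 / 2 : ℝ≥0∞) • Measure.dirac zeroSeq + (1 / 2 : ℝ≥0∞) • Measure.dirac (oneAt n)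

lemma zeroSeq_ne_oneAt (n : ℕ) : zeroSeq ≠ oneAt n := fun h => by
  simpa [zeroSeq, oneAt] using congrFun h n

lemma binMeasure_apply (n : ℕ) (s : Set (ℕ → Bool)) (hs : MeasurableSet s) :
    binMeasure n s = 1 / 2 * s.indicator 1 zeroSeq + 1 / 2 * s.indicator 1 (oneAt n) := by
  simp [binMeasure, Measure.dirac_apply' _ hs]

lemma binMeasure_univ (n : ℕ) : binMeasure n Set.univ = 1 := by
  simp [binMeasure_apply n _ MeasurableSet.univ, ENNReal.inv_two_add_inv_two]

lemma binMeasure_singleton_zeroSeq (n : ℕ) : binMeasure n {zeroSeq} = 1 / 2 := by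
  simp [binMeasure_apply n _ (measurableSet_singleton _), (zeroSeq_ne_oneAt n).symm]

lemma binMeasure_compl_singleton_zeroSeq (n : ℕ) : binMeasure n {zeroSeq}ᶜ = 1 / 2 := by
  simp [binMeasure_apply n _ (measurableSet_singleton _).compl, (zeroSeq_ne_oneAt n).symm]

lemma IsStopTime.measurableSet_ne_top {Ω : Type*} {m : MeasurableSpace Ω} {F : Filtration ℕ m}
    {τ : Ω → ℕ∞} (hτ : IsStopTime F τ) : MeasurableSet {ω | τ ω ≠ ⊤} := by
  have h : {ω | τ ω ≠ ⊤} = ⋃ t : ℕ, {ω | τ ω ≤ (t : ℕ∞)} := by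
    ext ω
    simp only [Set.mem_ofPred_eq, Set.mem_iUnion]
    refine ⟨fun h => ?_, fun ⟨t, ht⟩ => ne_top_of_le_ne_top (ENat.natCast_ne_top t) ht⟩
    obtain ⟨t, ht⟩ := ENat.ne_top_iff_exists.mp h
    exact ⟨t, ht.ge⟩
  rw [h]
  exact MeasurableSet.iUnion fun t => F.le t _ (hτ t)

/-- The number of coordinates one has to read to see the first `true`. -/
noncomputable def firstOne (ω : ℕ → Bool) : ℕ∞ := ⨅ (i : ℕ) (_ : ω i = true), ((i + 1 : ℕ) : ℕ∞)

lemma firstOne_le_iff (ω : ℕ → Bool) (t : ℕ) :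
    firstOne ω ≤ (t : ℕ∞) ↔ ∃ i : Fin t, ω i = true := by
  constructor
  · intro h
    by_contra! hne
    have : ((t + 1 : ℕ) : ℕ∞) ≤ firstOne ω := by
      refine le_iInf₂ fun i hi => ?_
      have : t ≤ i := not_lt.mp fun hlt => hne ⟨i, hlt⟩ hi
      exact_mod_cast Nat.succ_le_succ this
    have := this.trans h
    norm_cast at this
    omega
  · rintro ⟨i, hi⟩
    exact (iInf₂_le (i : ℕ) hi).trans (by exact_mod_cast i.isLt)

lemma setOf_firstOne_ne_top : {ω | firstOne ω ≠ ⊤} = {zeroSeq}ᶜ := by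
  ext ω
  simp [firstOne, zeroSeq, funext_iff, iInf_eq_top]

/-- For the binary-sequence example the two outer measures differ:
`sup_n P_n({0^∞}) = 1/2`, `μ*({0^∞}) = 1`, and `μ*(Ω \ {0^∞}) = 1/2`. -/
theorem binary_example (F : Filtration ℕ (inferInstance : MeasurableSpace (ℕ → Bool)))
    (hF : ∀ t : ℕ, (F t : MeasurableSpace (ℕ → Bool)) =
      MeasurableSpace.comap (fun ω (i : Fin t) => ω (i : ℕ)) inferInstance) :
    (⨆ n : ℕ, binMeasure n {zeroSeq}) = 1 / 2 ∧
    invCap F (Set.range binMeasure) {zeroSeq} = 1 ∧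
    invCap F (Set.range binMeasure) ({zeroSeq}ᶜ) = 1 / 2 := by
  have hfirst : IsStopTime F firstOne := by
    intro t
    rw [hF t]
    exact ⟨{f | ∃ i, f i = true}, Set.toFinite _ |>.measurableSet, by
      ext ω; simp [firstOne_le_iff]⟩
  refine ⟨by simp [binMeasure_singleton_zeroSeq], le_antisymm ?_ ?_, le_antisymm ?_ ?_⟩
  · refine (iInf₂_le (fun _ => 0) ⟨fun t => by simp, by simp⟩).trans ?_
    refine iSup₂_le ?_
    rintro _ ⟨n, rfl⟩
    simp [binMeasure_univ]
  · refine le_iInf₂ fun τ hτ => ?_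
    obtain ⟨t, ht⟩ := ENat.ne_top_iff_exists.mp (hτ.2 rfl)
    have hmeas := hτ.1 t
    rw [hF t] at hmeas
    obtain ⟨s, -, hs⟩ := hmeas
    have hagree : (fun i : Fin t => oneAt t i) = fun i : Fin t => zeroSeq i := by
      funext i
      simp [oneAt, zeroSeq, i.isLt.ne]
    have hzero : zeroSeq ∈ {ω | τ ω ≤ (t : ℕ∞)} := ht.ge
    have hone : oneAt t ∈ {ω | τ ω ≤ (t : ℕ∞)} := by
      rw [← hs, Set.mem_preimage] at hzero ⊢
      rwa [hagree]
    have hone' : τ (oneAt t) ≠ ⊤ := ne_top_of_le_ne_top (ENat.natCast_ne_top t) hone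
    have hzero' : τ zeroSeq ≠ ⊤ := hτ.2 rfl
    refine le_trans (le_of_eq ?_) (le_iSup₂ (binMeasure t) (Set.mem_range_self t))
    rw [binMeasure_apply t _ hτ.1.measurableSet_ne_top]
    simp [hone', hzero', ENNReal.inv_two_add_inv_two]
  · refine (iInf₂_le firstOne ⟨hfirst, setOf_firstOne_ne_top.ge⟩).trans ?_
    refine iSup₂_le ?_
    rintro _ ⟨n, rfl⟩
    rw [setOf_firstOne_ne_top, binMeasure_compl_singleton_zeroSeq]
  · refine le_iInf₂ fun τ hτ => ?_
    rw [← binMeasure_compl_singleton_zeroSeq 0]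
    exact (measure_mono hτ.2).trans
      (le_iSup₂ (f := fun (P : Measure (ℕ → Bool)) (_ : P ∈ Set.range binMeasure) =>
        P {ω | τ ω ≠ ⊤}) (binMeasure 0) (Set.mem_range_self 0))
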